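/- Let X and Y be Polish spaces, t ≥ 1, let C : X × P_t(Y) → ℝ ∪ {+∞} satisfy property (A), and let μ ∈ P(X), ν ∈ P_t(Y) with V_C(μ,ν) finite. Then every optimizer π* of V_C(μ,ν) = inf_{π ∈ Π(μ,ν)} ∫_X C(x,π_x) μ(dx) is C-monotone: there is a C-monotone set Γ ⊂ X × P_t(Y) such that the image of μ under x ↦ (x, π*_x) is concentrated on Γ. -/

import Mathlib

open MeasureTheory ProbabilityTheory ENNReal NNReal

noncomputable section

/-- A probability measure has finite `t`-th moment. -/
def MemPt {Z : Type*} [MetricSpace Z] [MeasurableSpace Z] (t : ℝ)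
    (p : ProbabilityMeasure Z) : Prop :=
  ∃ z₀ : Z, Integrable (fun z => dist z z₀ ^ t) (p : Measure Z)

/-- The class `Φ_t` of continuous functions with growth of order at most `t`. -/
def PhiT (t : ℝ) (Y : Type*) [MetricSpace Y] : Set (Y → ℝ) :=
  {g | Continuous g ∧ ∃ (K : ℝ) (y₀ : Y), ∀ y, |g y| ≤ K * (1 + dist y y₀ ^ t)}

/-- The space `𝒫_t(Y)` of probability measures with finite `t`-th moment. -/
def PtSpace (t : ℝ) (Y : Type*) [MetricSpace Y] [MeasurableSpace Y] : Type _ :=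
  {p : ProbabilityMeasure Y // MemPt t p}

/-- The `t`-Wasserstein topology on `𝒫_t(Y)`: the initial topology for the maps
`p ↦ ∫ g dp`, `g ∈ Φ_t(Y)`. -/
noncomputable instance (t : ℝ) (Y : Type*) [MetricSpace Y] [MeasurableSpace Y] :
    TopologicalSpace (PtSpace t Y) :=
  ⨅ g ∈ PhiT t Y,
    TopologicalSpace.induced
      (fun p : PtSpace t Y => ∫ y, g y ∂((p.1 : Measure Y))) inferInstance

variable {X Y : Type*} [MetricSpace X] [PolishSpace X] [MeasurableSpace X] [BorelSpace X]
  [MetricSpace Y] [PolishSpace Y] [MeasurableSpace Y] [BorelSpace Y] [Nonempty Y]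

/-- `π` is a coupling of `μ` and `ν`. -/
def IsCoupling (μ : ProbabilityMeasure X) (ν : ProbabilityMeasure Y)
    (π : ProbabilityMeasure (X × Y)) : Prop :=
  (π : Measure (X × Y)).map Prod.fst = (μ : Measure X) ∧
    (π : Measure (X × Y)).map Prod.snd = (ν : Measure Y)

/-- The disintegration `x ↦ π_x` of a coupling with respect to its first marginal,
as a map into probability measures. -/
noncomputable def disint (π : ProbabilityMeasure (X × Y)) (x : X) : ProbabilityMeasure Y :=
  ⟨(π : Measure (X × Y)).condKernel x, inferInstance⟩

/-- The weak transport cost `∫ C(x, π_x) μ(dx)` of a coupling `π`. -/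
noncomputable def weakCost (C : X → ProbabilityMeasure Y → ℝ≥0∞)
    (μ : ProbabilityMeasure X) (π : ProbabilityMeasure (X × Y)) : ℝ≥0∞ :=
  ∫⁻ x, C x (disint π x) ∂(μ : Measure X)

/-- The value of the weak transport problem (OWT). -/
noncomputable def weakValue (C : X → ProbabilityMeasure Y → ℝ≥0∞)
    (μ : ProbabilityMeasure X) (ν : ProbabilityMeasure Y) : ℝ≥0∞ :=
  ⨅ (π : ProbabilityMeasure (X × Y)) (_ : IsCoupling μ ν π), weakCost C μ π

/-- A set `Γ ⊆ X × 𝒫_t(Y)` is `C`-monotone if for any finitely many points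
`(x_k, p_k)` of `Γ` and any competitors `q_k ∈ 𝒫_t(Y)` with `∑ q_k = ∑ p_k`, one has
`∑ C(x_k, p_k) ≤ ∑ C(x_k, q_k)`. -/
def CMonotone (t : ℝ) (C : X → ProbabilityMeasure Y → ℝ≥0∞)
    (Γ : Set (X × ProbabilityMeasure Y)) : Prop :=
  ∀ (N : ℕ) (x : Fin N → X) (p q : Fin N → ProbabilityMeasure Y),
    (∀ k, (x k, p k) ∈ Γ) → (∀ k, MemPt t (q k)) →
    (∑ k, ((p k : Measure Y)) = ∑ k, ((q k : Measure Y))) →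
    (∑ k, C (x k) (p k)) ≤ ∑ k, C (x k) (q k)

section Auxiliary

set_option linter.unusedSectionVars false

open Filter Topology TopologicalSpace

section LowerSemicontinuousIntegral

variable {K : Type*} [TopologicalSpace K] [MetrizableSpace K] [SeparableSpace K]
  [MeasurableSpace K] [BorelSpace K]

lemma lintegral_ofReal_le_liminf_of_tendsto {f : K → ℝ} (hf : LowerSemicontinuous f) (hf0 : 0 ≤ f)
    {P : ProbabilityMeasure K} {Ps : ℕ → ProbabilityMeasure K} (h : Tendsto Ps atTop (𝓝 P)) :
    ∫⁻ x, ENNReal.ofReal (f x) ∂(P : Measure K) ≤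
      atTop.liminf fun i => ∫⁻ x, ENNReal.ofReal (f x) ∂(Ps i : Measure K) := by
  simp_rw [lintegral_eq_lintegral_meas_lt _ (Eventually.of_forall hf0) hf.measurable.aemeasurable]
  refine le_trans (lintegral_mono fun t => ?_) (lintegral_liminf_le fun n =>
    Antitone.measurable fun s t hst => measure_mono fun ω hω => lt_of_le_of_lt hst hω)
  exact ProbabilityMeasure.le_liminf_measure_open_of_tendsto h (hf.isOpen_preimage t)

/-- Integration against a nonnegative lower semicontinuous function is lower semicontinuous for
weak convergence. -/
lemma lowerSemicontinuous_lintegral {f : K → ℝ≥0∞} (hf : LowerSemicontinuous f) :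
    LowerSemicontinuous fun P : ProbabilityMeasure K => ∫⁻ x, f x ∂(P : Measure K) := by
  have hmin : ∀ n : ℕ, LowerSemicontinuous fun P : ProbabilityMeasure K =>
      ∫⁻ x, min (f x) n ∂(P : Measure K) := by
    intro n
    have hne : ∀ x, min (f x) (n : ℝ≥0∞) ≠ ⊤ := fun x =>
      ne_top_of_le_ne_top (ENNReal.natCast_ne_top n) (min_le_right _ _)
    have hlsc : LowerSemicontinuous fun x => (min (f x) (n : ℝ≥0∞)).toReal := by
      intro x y hy
      rcases lt_or_ge y 0 with hy0 | hy0
      · exact Eventually.of_forall fun z => hy0.trans_le ENNReal.toReal_nonneg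
      · have h1 : ENNReal.ofReal y < min (f x) n :=
          (ENNReal.ofReal_lt_iff_lt_toReal hy0 (hne x)).2 hy
        filter_upwards [hf x _ (h1.trans_le (min_le_left _ _))] with z hz
        exact (ENNReal.ofReal_lt_iff_lt_toReal hy0 (hne z)).1
          (lt_min hz (h1.trans_le (min_le_right _ _)))
    refine lowerSemicontinuous_iff_isClosed_preimage.2 fun y => IsSeqClosed.isClosed ?_
    intro Ps P hPs hP
    have := lintegral_ofReal_le_liminf_of_tendsto hlsc (fun x => ENNReal.toReal_nonneg) hP
    simp_rw [ENNReal.ofReal_toReal (hne _)] at this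
    refine this.trans (liminf_le_of_frequently_le' (Eventually.of_forall hPs).frequently)
  have heq : (fun P : ProbabilityMeasure K => ∫⁻ x, f x ∂(P : Measure K)) =
      fun P : ProbabilityMeasure K => ⨆ n : ℕ, ∫⁻ x, min (f x) n ∂(P : Measure K) := by
    ext P
    rw [← lintegral_iSup]
    · congr with x
      rw [← inf_iSup_eq, ENNReal.iSup_natCast, inf_top_eq]
    · exact fun n => hf.measurable.min measurable_const
    · intro n m hnm x
      exact min_le_min_left _ (Nat.cast_le.2 hnm)
  rw [heq]
  exact lowerSemicontinuous_iSup hmin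

lemma measurable_toMeasure_borel :
    Measurable[borel (ProbabilityMeasure K)]
      (fun P : ProbabilityMeasure K => (P : Measure K)) := by
  let : MeasurableSpace (ProbabilityMeasure K) := borel _
  have : BorelSpace (ProbabilityMeasure K) := ⟨rfl⟩
  refine Measurable.measure_of_isPiSystem_of_isProbabilityMeasure
    (BorelSpace.measurable_eq (α := K)) isPiSystem_isOpen fun U hU => ?_
  have := lowerSemicontinuous_lintegral (hU.lowerSemicontinuous_indicator (y := (1 : ℝ≥0∞)) zero_le)
  simpa [lintegral_indicator_const hU.measurableSet] using this.measurable

end LowerSemicontinuousIntegral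

section BorelProbabilityMeasure

variable {K : Type*} [TopologicalSpace K] [CompactSpace K] [MetrizableSpace K]
  [MeasurableSpace K] [BorelSpace K]

instance : SecondCountableTopology (ProbabilityMeasure K) := by
  let := metrizableSpaceMetric K
  let := metrizableSpaceMetric (ProbabilityMeasure K)
  infer_instance

instance : PolishSpace (ProbabilityMeasure K) := by
  let := metrizableSpaceMetric K
  let := metrizableSpaceMetric (ProbabilityMeasure K)
  infer_instance

lemma continuous_integral_continuousMap (g : C(K, ℝ)) :
    Continuous fun P : ProbabilityMeasure K => ∫ x, g x ∂(P : Measure K) :=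
  ProbabilityMeasure.continuous_integral_boundedContinuousFunction
    (BoundedContinuousFunction.mkOfCompact g)

/-- The tautological kernel from probability measures on a space to that space. -/
def tautologicalKernel (K : Type*) [MeasurableSpace K] : Kernel (ProbabilityMeasure K) K :=
  ⟨fun P => (P : Measure K), measurable_subtype_coe⟩

instance (K : Type*) [MeasurableSpace K] : IsMarkovKernel (tautologicalKernel K) :=
  ⟨fun P => inferInstanceAs (IsProbabilityMeasure (P : Measure K))⟩

lemma continuous_continuousMap_integral (P : ProbabilityMeasure K) :
    Continuous fun g : C(K, ℝ) => ∫ x, g x ∂(P : Measure K) := by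
  refine LipschitzWith.continuous (K := 1) (LipschitzWith.of_dist_le_mul fun f g => ?_)
  have hint : ∀ f : C(K, ℝ), Integrable f (P : Measure K) := fun f =>
    (BoundedContinuousFunction.mkOfCompact f).integrable _
  rw [Real.dist_eq, ← integral_sub (hint f) (hint g), ← Real.norm_eq_abs]
  refine (norm_integral_le_of_norm_le_const (C := dist f g)
    (Eventually.of_forall fun x => ?_)).trans
    (by simp)
  simpa [dist_eq_norm] using (f - g).norm_coe_le_norm x

lemma ext_of_forall_continuousMap_integral_eq {P Q : Measure K} [IsFiniteMeasure P]
    [IsFiniteMeasure Q] (h : ∀ g : C(K, ℝ), ∫ x, g x ∂P = ∫ x, g x ∂Q) : P = Q :=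
  ext_of_forall_integral_eq_of_IsFiniteMeasure fun f => h f.toContinuousMap

instance : BorelSpace (ProbabilityMeasure K) := by
  let := metrizableSpaceMetric K
  constructor
  refine le_antisymm ?_ ?_
  · rintro _ ⟨s, hs, rfl⟩
    exact measurable_toMeasure_borel hs
  · let e : ProbabilityMeasure K → ℕ → ℝ := fun P n =>
      ∫ x, TopologicalSpace.denseSeq C(K, ℝ) n x ∂(P : Measure K)
    have he : Continuous e := continuous_pi fun n => continuous_integral_continuousMap _
    have hinj : Function.Injective e := by
      intro P Q hPQ
      have := (denseRange_denseSeq C(K, ℝ)).equalizer (continuous_continuousMap_integral P)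
        (continuous_continuousMap_integral Q) (funext fun n => congrFun hPQ n)
      exact ProbabilityMeasure.toMeasure_injective
        (ext_of_forall_continuousMap_integral_eq (P := (P : Measure K)) (Q := Q) (congrFun this))
    have hemb : IsClosedEmbedding e := he.isClosedEmbedding hinj
    rw [hemb.isInducing.eq_induced, borel_comap, ← BorelSpace.measurable_eq]
    refine Measurable.comap_le (measurable_pi_lambda _ fun n => ?_)
    exact (StronglyMeasurable.integral_kernel (κ := tautologicalKernel K)
      (TopologicalSpace.denseSeq C(K, ℝ) n).continuous.stronglyMeasurable).measurable

end BorelProbabilityMeasure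

section LinearProgram

variable {K : Type*} [TopologicalSpace K] [CompactSpace K] [MetrizableSpace K]
  [MeasurableSpace K] [BorelSpace K]

lemma exists_probabilityMeasure_mix (P Q : ProbabilityMeasure K) {a b : ℝ} (ha : 0 ≤ a) (hb : 0 ≤ b)
    (hab : a + b = 1) : ∃ R : ProbabilityMeasure K,
      (R : Measure K) = ENNReal.ofReal a • (P : Measure K) + ENNReal.ofReal b • (Q : Measure K) :=
  ⟨⟨ENNReal.ofReal a • (P : Measure K) + ENNReal.ofReal b • (Q : Measure K),
    ⟨by simp [← ENNReal.ofReal_add ha hb, hab]⟩⟩, rfl⟩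

/-- The attainable values of finitely many linear constraints and two cost bounds. -/
def attainable {ι : Type*} (h : ι → C(K, ℝ)) (s c : K → ℝ≥0∞) : Set ((ι → ℝ) × ℝ × ℝ) :=
  {v | 0 ≤ v.2.1 ∧ 0 ≤ v.2.2 ∧ ∃ P : ProbabilityMeasure K,
    (∀ i, ∫ z, h i z ∂(P : Measure K) = v.1 i) ∧
    ∫⁻ z, s z ∂(P : Measure K) ≤ ENNReal.ofReal v.2.1 ∧
    ∫⁻ z, c z ∂(P : Measure K) ≤ ENNReal.ofReal v.2.2}

lemma convex_attainable {ι : Type*} (h : ι → C(K, ℝ)) (s c : K → ℝ≥0∞) :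
    Convex ℝ (attainable h s c) := by
  rintro v ⟨hv1, hv2, P, hP, hPs, hPc⟩ w ⟨hw1, hw2, Q, hQ, hQs, hQc⟩ a b ha hb hab
  obtain ⟨R, hR⟩ := exists_probabilityMeasure_mix P Q ha hb hab
  have hint : ∀ (P : ProbabilityMeasure K) (f : C(K, ℝ)), Integrable f (P : Measure K) := fun P f =>
    (BoundedContinuousFunction.mkOfCompact f).integrable _
  have hle : ∀ (f : K → ℝ≥0∞) (x y : ℝ), 0 ≤ x → 0 ≤ y →
      ∫⁻ z, f z ∂(P : Measure K) ≤ ENNReal.ofReal x →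
      ∫⁻ z, f z ∂(Q : Measure K) ≤ ENNReal.ofReal y →
      ∫⁻ z, f z ∂(R : Measure K) ≤ ENNReal.ofReal (a * x + b * y) := by
    intro f x y hx hy hfx hfy
    rw [hR, lintegral_add_measure, lintegral_smul_measure, lintegral_smul_measure,
      ENNReal.ofReal_add (by positivity) (by positivity), ENNReal.ofReal_mul ha,
      ENNReal.ofReal_mul hb]
    simp only [smul_eq_mul]
    gcongr
  refine ⟨?_, ?_, R, fun i => ?_, ?_, ?_⟩
  · simp only [Prod.snd_add, Prod.smul_snd, Prod.fst_add, Prod.smul_fst, smul_eq_mul]; positivity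
  · simp only [Prod.snd_add, Prod.smul_snd, smul_eq_mul]; positivity
  · rw [hR, integral_add_measure ((hint P _).smul_measure (by simp))
      ((hint Q _).smul_measure (by simp)), integral_smul_measure, integral_smul_measure, hP, hQ]
    simp [ENNReal.toReal_ofReal ha, ENNReal.toReal_ofReal hb]
  · exact hle s _ _ hv1 hw1 hPs hQs
  · exact hle c _ _ hv2 hw2 hPc hQc

lemma isClosed_attainable {ι : Type*} (h : ι → C(K, ℝ)) {s c : K → ℝ≥0∞}
    (hs : LowerSemicontinuous s) (hc : LowerSemicontinuous c) :
    IsClosed (attainable h s c) := by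
  have hepi : ∀ {f : K → ℝ≥0∞}, LowerSemicontinuous f → ∀ φ : (ι → ℝ) × ℝ × ℝ → ℝ, Continuous φ →
      IsClosed {q : ProbabilityMeasure K × ((ι → ℝ) × ℝ × ℝ) |
        ∫⁻ z, f z ∂(q.1 : Measure K) ≤ ENNReal.ofReal (φ q.2)} := fun hf φ hφ =>
    (lowerSemicontinuous_iff_isClosed_epigraph.1 (lowerSemicontinuous_lintegral hf)).preimage
      (f := fun q : ProbabilityMeasure K × ((ι → ℝ) × ℝ × ℝ) => (q.1, ENNReal.ofReal (φ q.2)))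
      (continuous_fst.prodMk (ENNReal.continuous_ofReal.comp (hφ.comp continuous_snd)))
  have hcl : IsClosed {q : ProbabilityMeasure K × ((ι → ℝ) × ℝ × ℝ) |
      ((∀ i, ∫ z, h i z ∂(q.1 : Measure K) = q.2.1 i) ∧
      ∫⁻ z, s z ∂(q.1 : Measure K) ≤ ENNReal.ofReal q.2.2.1 ∧
      ∫⁻ z, c z ∂(q.1 : Measure K) ≤ ENNReal.ofReal q.2.2.2)} := by
    refine IsClosed.and ?_ (IsClosed.and (hepi hs (fun v => v.2.1) (by fun_prop))
      (hepi hc (fun v => v.2.2) (by fun_prop)))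
    rw [Set.ofPred_forall]
    exact isClosed_iInter fun i => isClosed_eq
      ((continuous_integral_continuousMap (h i)).comp continuous_fst) (by fun_prop)
  have := isClosedMap_snd_of_compactSpace _ hcl
  have h0 : IsClosed {v : (ι → ℝ) × ℝ × ℝ | 0 ≤ v.2.1 ∧ 0 ≤ v.2.2} :=
    IsClosed.and (isClosed_le continuous_const (by fun_prop))
      (isClosed_le continuous_const (by fun_prop))
  convert! h0.inter this using 1
  ext v
  constructor
  · rintro ⟨h1, h2, P, h3⟩
    exact ⟨⟨h1, h2⟩, (P, v), h3, rfl⟩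
  · rintro ⟨⟨h1, h2⟩, ⟨P, _⟩, h3, rfl⟩
    exact ⟨h1, h2, P, h3⟩

lemma exists_finset_infeasible {M : Type*} (h : M → C(K, ℝ))
    {s c : K → ℝ≥0∞} (hs : LowerSemicontinuous s) (hc : LowerSemicontinuous c) {S r : ℝ}
    (hinf : ¬ (0 ≤ S ∧ 0 ≤ r ∧ ∃ P : ProbabilityMeasure K, (∀ m, ∫ z, h m z ∂(P : Measure K) = 0) ∧
      ∫⁻ z, s z ∂(P : Measure K) ≤ ENNReal.ofReal S ∧
      ∫⁻ z, c z ∂(P : Measure K) ≤ ENNReal.ofReal r)) :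
    ∃ F : Finset M, ((0, S, r) : (F → ℝ) × ℝ × ℝ) ∉ attainable (fun i : F => h i) s c := by
  let T : Set (ProbabilityMeasure K) := {P | ∫⁻ z, s z ∂(P : Measure K) ≤ ENNReal.ofReal S} ∩
    {P | ∫⁻ z, c z ∂(P : Measure K) ≤ ENNReal.ofReal r}
  have hT : IsCompact T := (((lowerSemicontinuous_lintegral hs).isClosed_preimage _).inter
    ((lowerSemicontinuous_lintegral hc).isClosed_preimage _)).isCompact
  by_cases hSr : 0 ≤ S ∧ 0 ≤ r
  · obtain ⟨F, hF⟩ := hT.elim_finite_subfamily_closed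
      (fun m => {P : ProbabilityMeasure K | ∫ z, h m z ∂(P : Measure K) = 0})
      (fun m => isClosed_eq (continuous_integral_continuousMap (h m)) continuous_const) (by
        rw [Set.eq_empty_iff_forall_notMem]
        rintro P ⟨⟨h1, h2⟩, h3⟩
        exact hinf ⟨hSr.1, hSr.2, P, fun m => Set.mem_iInter.1 h3 m, h1, h2⟩)
    refine ⟨F, ?_⟩
    rintro ⟨-, -, P, h1, h2, h3⟩
    refine (Set.eq_empty_iff_forall_notMem.1 hF) P ⟨⟨h2, h3⟩, ?_⟩
    exact Set.mem_iInter₂.2 fun m hm => h1 ⟨m, hm⟩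
  · exact ⟨∅, fun hmem => hSr ⟨hmem.1, hmem.2.1⟩⟩

/-- Farkas-type alternative: an infeasible linear program over the probability measures on a compact
space admits a separating multiplier. -/
lemma exists_multiplier_of_infeasible {M : Type*} [AddCommGroup M] [Module ℝ M]
    (H : M →ₗ[ℝ] C(K, ℝ))
    {s c : K → ℝ≥0∞} (hs : LowerSemicontinuous s) (hc : LowerSemicontinuous c) {S r : ℝ}
    (hinf : ¬ (0 ≤ S ∧ 0 ≤ r ∧ ∃ P : ProbabilityMeasure K, (∀ m, ∫ z, H m z ∂(P : Measure K) = 0) ∧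
      ∫⁻ z, s z ∂(P : Measure K) ≤ ENNReal.ofReal S ∧
      ∫⁻ z, c z ∂(P : Measure K) ≤ ENNReal.ofReal r)) :
    ∃ (m : M) (l l₀ δ : ℝ), 0 ≤ l ∧ 0 ≤ l₀ ∧ 0 < δ ∧ ∀ z, s z ≠ ⊤ → c z ≠ ⊤ →
      δ ≤ H m z + l * ((s z).toReal - S) + l₀ * ((c z).toReal - r) := by
  classical
  obtain ⟨F, hF⟩ := exists_finset_infeasible (fun m => H m) hs hc hinf
  set A := attainable (fun i : F => H i) s c
  have hdirac : ∀ z, s z ≠ ⊤ → c z ≠ ⊤ →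
      ((fun i : F => H i z, (s z).toReal, (c z).toReal) : (F → ℝ) × ℝ × ℝ) ∈ A := by
    intro z hsz hcz
    refine ⟨ENNReal.toReal_nonneg, ENNReal.toReal_nonneg, ⟨Measure.dirac z, inferInstance⟩, ?_⟩
    simp [hsz, hcz]
  obtain hA | ⟨⟨v₀, a₀, b₀⟩, hv₀⟩ := A.eq_empty_or_nonempty
  · refine ⟨0, 0, 0, 1, le_rfl, le_rfl, one_pos, fun z hsz hcz => ?_⟩
    simpa [hA] using hdirac z hsz hcz
  obtain ⟨f, u, hfu, hu⟩ := geometric_hahn_banach_point_closed (convex_attainable _ s c)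
    (isClosed_attainable (fun i : F => H i) hs hc) hF
  have hf : ∀ v a b, f (v, a, b) = f (v, 0, 0) + a * f (0, 1, 0) + b * f (0, 0, 1) := by
    intro v a b
    have : ((v, a, b) : (F → ℝ) × ℝ × ℝ) = (v, 0, 0) + a • (0, 1, 0) + b • (0, 0, 1) := by
      simp
    rw [this, map_add, map_add, map_smul, map_smul]
    rfl
  have hnonneg : ∀ x y : ℝ, (∀ τ, 0 ≤ τ → u < x + τ * y) → 0 ≤ y := by
    intro x y hxy
    by_contra! hy
    have h1 := hxy (max 0 ((u - x) / y)) (le_max_left _ _)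
    have h2 : max 0 ((u - x) / y) * y ≤ (u - x) / y * y :=
      mul_le_mul_of_nonpos_right (le_max_right _ _) hy.le
    rw [div_mul_cancel₀ _ hy.ne] at h2
    linarith
  have hl : 0 ≤ f (0, 1, 0) := by
    refine hnonneg (f (v₀, a₀, b₀)) _ fun τ hτ => ?_
    obtain ⟨h1, h2, P, h3, h4, h5⟩ := hv₀
    have := hu (v₀, a₀ + τ, b₀) ⟨add_nonneg h1 hτ, h2, P, h3,
      h4.trans (ENNReal.ofReal_le_ofReal (by simpa using hτ)), h5⟩
    rw [hf] at this ⊢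
    linarith
  have hl₀ : 0 ≤ f (0, 0, 1) := by
    refine hnonneg (f (v₀, a₀, b₀)) _ fun τ hτ => ?_
    obtain ⟨h1, h2, P, h3, h4, h5⟩ := hv₀
    have := hu (v₀, a₀, b₀ + τ) ⟨h1, add_nonneg h2 hτ, P, h3, h4,
      h5.trans (ENNReal.ofReal_le_ofReal (by simpa using hτ))⟩
    rw [hf] at this ⊢
    linarith
  refine ⟨∑ i : F, f (Pi.single i 1, 0, 0) • (i : M), f (0, 1, 0), f (0, 0, 1), u - f (0, S, r),
    hl, hl₀, sub_pos.2 hfu, fun z hsz hcz => ?_⟩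
  have hsum : H (∑ i : F, f (Pi.single i 1, 0, 0) • (i : M)) z = f (fun i : F => H i z, 0, 0) := by
    have := LinearMap.pi_apply_eq_sum_univ
      ((f : ((F → ℝ) × ℝ × ℝ) →ₗ[ℝ] ℝ) ∘ₗ LinearMap.inl ℝ (F → ℝ) (ℝ × ℝ)) (fun i : F => H i z)
    simp only [LinearMap.comp_apply, LinearMap.inl_apply, ContinuousLinearMap.coe_coe] at this
    rw [show ((fun i : F => H i z, 0, 0) : (F → ℝ) × ℝ × ℝ) = (fun i : F => H i z, 0) from rfl,
      this,
      map_sum, ContinuousMap.coe_sum, Finset.sum_apply]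
    refine Finset.sum_congr rfl fun i _ => ?_
    rw [map_smul, ContinuousMap.smul_apply, smul_eq_mul, smul_eq_mul, mul_comm]
    congr 3
    ext j
    simp [Pi.single_apply, eq_comm]
  have h1 := hu _ (hdirac z hsz hcz)
  rw [hf] at h1
  have h2 := hf 0 S r
  rw [show f (0, 0, 0) = 0 from map_zero f] at h2
  rw [hsum, h2]
  linarith

end LinearProgram

section LscEnvelope

variable {A B : Type*} [TopologicalSpace B]

/-- The largest lower semicontinuous function on the codomain of `ι` lying below `h` along `ι`;
it is `⊤` off the closure of the range of `ι`. -/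
def lscEnvelope (ι : A → B) (h : A → ℝ≥0∞) (z : B) : ℝ≥0∞ :=
  liminf h (comap ι (𝓝 z))

lemma lowerSemicontinuous_lscEnvelope (ι : A → B) (h : A → ℝ≥0∞) :
    LowerSemicontinuous (lscEnvelope ι h) := by
  intro z r hr
  obtain ⟨r', hr', hr''⟩ := exists_between hr
  obtain ⟨U, hU, hUz⟩ := mem_comap.1 (eventually_lt_of_lt_liminf hr'')
  filter_upwards [eventually_mem_nhds_iff.2 hU] with z' hz'
  exact hr'.trans_le (le_liminf_of_le (by isBoundedDefault)
    (Eventually.mono (preimage_mem_comap hz') fun a ha => (hUz ha).le))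

lemma lscEnvelope_apply [TopologicalSpace A] {ι : A → B} {h : A → ℝ≥0∞}
    (hh : LowerSemicontinuous h) {a : A} (ha : comap ι (𝓝 (ι a)) ≤ 𝓝 a) :
    lscEnvelope ι h (ι a) = h a := by
  refine le_antisymm (liminf_le_of_frequently_le' ?_) ?_
  · intro hcon
    obtain ⟨U, hU, hUz⟩ := mem_comap.1 hcon
    exact hUz (show ι a ∈ U from mem_of_mem_nhds hU) le_rfl
  · refine le_of_forall_lt fun r hr => ?_
    obtain ⟨r', hr', hr''⟩ := exists_between hr
    exact hr'.trans_le (le_liminf_of_le (by isBoundedDefault)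
      (Eventually.mono (ha (hh a r' hr'')) fun a ha => le_of_lt ha))

lemma mem_closure_range_of_lscEnvelope_ne_top {ι : A → B} {h : A → ℝ≥0∞} {z : B}
    (hz : lscEnvelope ι h z ≠ ⊤) : z ∈ closure (Set.range ι) := by
  have hne : (comap ι (𝓝 z)).NeBot := by
    by_contra hbot
    exact hz (by simp [lscEnvelope, not_neBot.1 hbot])
  refine mem_closure_iff_nhds.2 fun U hU => ?_
  obtain ⟨a, ha⟩ := comap_neBot_iff.1 hne U hU
  exact ⟨ι a, ha, Set.mem_range_self a⟩

end LscEnvelope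

section Moments

variable {Y : Type*} [MetricSpace Y]

lemma exists_dist_rpow_le {t : ℝ} (ht : 1 ≤ t) (y₀ y₁ : Y) :
    ∃ K : ℝ, 0 ≤ K ∧ ∀ y, dist y y₁ ^ t ≤ K * (1 + dist y y₀ ^ t) := by
  refine ⟨2 ^ (t - 1) * (1 + dist y₀ y₁ ^ t), by positivity, fun y => ?_⟩
  have h := Real.rpow_le_rpow dist_nonneg (dist_triangle y y₀ y₁) (zero_le_one.trans ht)
  have h2 : (dist y y₀ + dist y₀ y₁) ^ t ≤ 2 ^ (t - 1) * (dist y y₀ ^ t + dist y₀ y₁ ^ t) := by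
    have := NNReal.rpow_add_le_mul_rpow_add_rpow (nndist y y₀) (nndist y₀ y₁) ht
    exact_mod_cast this
  refine (h.trans h2).trans ?_
  rw [mul_assoc]
  refine mul_le_mul_of_nonneg_left ?_ (by positivity)
  have h3 : 0 ≤ dist y y₀ ^ t := by positivity
  have h4 : 0 ≤ dist y₀ y₁ ^ t := by positivity
  nlinarith [mul_nonneg h3 h4]

lemma continuous_dist_rpow {t : ℝ} (ht : 1 ≤ t) (y₀ : Y) : Continuous fun y : Y => dist y y₀ ^ t :=
  (continuous_id.dist continuous_const).rpow_const fun _ => Or.inr (zero_le_one.trans ht)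

lemma exists_abs_le_of_mem_phiT {t : ℝ} (ht : 1 ≤ t) (y₀ : Y) {g : Y → ℝ} (hg : g ∈ PhiT t Y) :
    ∃ K : ℝ, 0 ≤ K ∧ ∀ y, |g y| ≤ K * (1 + dist y y₀ ^ t) := by
  obtain ⟨-, K, y₁, hK⟩ := hg
  obtain ⟨L, hL, hL'⟩ := exists_dist_rpow_le ht y₀ y₁
  refine ⟨|K| * (1 + L), by positivity, fun y => (hK y).trans ?_⟩
  have h3 : 0 ≤ dist y y₀ ^ t := by positivity
  have h4 : 0 ≤ dist y y₁ ^ t := by positivity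
  calc K * (1 + dist y y₁ ^ t) ≤ |K| * (1 + dist y y₁ ^ t) := by gcongr; exact le_abs_self K
    _ ≤ |K| * ((1 + L) * (1 + dist y y₀ ^ t)) := by gcongr; nlinarith [hL' y]
    _ = _ := by ring

variable [MeasurableSpace Y] [BorelSpace Y]

lemma MemPt.integrable {t : ℝ} (ht : 1 ≤ t) {p : ProbabilityMeasure Y} (hp : MemPt t p) (y₀ : Y) :
    Integrable (fun y => dist y y₀ ^ t) (p : Measure Y) := by
  obtain ⟨y₁, h⟩ := hp
  obtain ⟨K, -, hK⟩ := exists_dist_rpow_le ht y₁ y₀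
  refine (((integrable_const 1).add h).const_mul K).mono'
    (continuous_dist_rpow ht y₀).measurable.aestronglyMeasurable (Eventually.of_forall fun y => ?_)
  rw [Real.norm_eq_abs, abs_of_nonneg (by positivity)]
  exact hK y

lemma MemPt.integrable_phiT {t : ℝ} (ht : 1 ≤ t) {p : ProbabilityMeasure Y} (hp : MemPt t p)
    {g : Y → ℝ} (hg : g ∈ PhiT t Y) : Integrable g (p : Measure Y) := by
  obtain ⟨y₀, -⟩ := id hp
  obtain ⟨K, -, hK⟩ := exists_abs_le_of_mem_phiT ht y₀ hg
  exact (((integrable_const 1).add (hp.integrable ht y₀)).const_mul K).mono'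
    hg.1.measurable.aestronglyMeasurable (Eventually.of_forall hK)

/-- The `t`-th moment about `y₀` of a measure. -/
def distMoment (t : ℝ) (y₀ : Y) (p : Measure Y) : ℝ≥0∞ :=
  ∫⁻ y, ENNReal.ofReal (dist y y₀ ^ t) ∂p

lemma memPt_iff_distMoment_ne_top {t : ℝ} (ht : 1 ≤ t) (y₀ : Y) {p : ProbabilityMeasure Y} :
    MemPt t p ↔ distMoment t y₀ (p : Measure Y) ≠ ⊤ := by
  have hm := (continuous_dist_rpow ht y₀).measurable.aestronglyMeasurable (μ := (p : Measure Y))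
  have hnn : ∀ y, 0 ≤ dist y y₀ ^ t := fun y => by positivity
  refine ⟨fun h => (h.integrable ht y₀).lintegral_lt_top.ne, fun h => ⟨y₀, ?_⟩⟩
  exact (lintegral_ofReal_ne_top_iff_integrable hm (Eventually.of_forall hnn)).1 h

lemma integral_dist_rpow_eq_distMoment {t : ℝ} (ht : 1 ≤ t) {p : ProbabilityMeasure Y} (y₀ : Y) :
    ∫ y, dist y y₀ ^ t ∂(p : Measure Y) = (distMoment t y₀ (p : Measure Y)).toReal :=
  integral_eq_lintegral_of_nonneg_ae (Eventually.of_forall fun y => by positivity)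
    (continuous_dist_rpow ht y₀).measurable.aestronglyMeasurable

end Moments

section Compactification

variable {X Y K L : Type*} [MetricSpace Y] [MeasurableSpace Y] [BorelSpace Y] [TopologicalSpace X]
  [TopologicalSpace K] [TopologicalSpace L] [CompactSpace L] [MetrizableSpace L]
  [MeasurableSpace L] [BorelSpace L]

/-- A probability measure, seen on a compactification and paired with its `t`-th moment. -/
def embedMoment (t : ℝ) (y₀ : Y) {b : Y → L} (hb : IsEmbedding b) (p : ProbabilityMeasure Y) :
    ProbabilityMeasure L × ℝ≥0∞ :=
  (p.map hb.continuous.measurable.aemeasurable, distMoment t y₀ (p : Measure Y))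

lemma lintegral_lscEnvelope_map {b : Y → L} (hb : IsEmbedding b) {u : Y → ℝ≥0∞}
    (hu : LowerSemicontinuous u) (p : ProbabilityMeasure Y) :
    ∫⁻ z, lscEnvelope b u z ∂(p.map hb.continuous.measurable.aemeasurable : Measure L) =
      ∫⁻ y, u y ∂(p : Measure Y) := by
  rw [ProbabilityMeasure.toMeasure_map,
    lintegral_map (lowerSemicontinuous_lscEnvelope b u).measurable hb.continuous.measurable]
  congr with y
  exact lscEnvelope_apply hu (hb.isInducing.nhds_eq_comap y).ge

lemma eventually_lt_integral_of_mem_phiT {t : ℝ} (ht : 1 ≤ t) (y₀ : Y) {b : Y → L}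
    (hb : IsEmbedding b) (p : PtSpace t Y) {g : Y → ℝ} (hg : g ∈ PhiT t Y) {r : ℝ}
    (hr : r < ∫ y, g y ∂(p.1 : Measure Y)) :
    ∀ᶠ q : PtSpace t Y in comap (fun q => embedMoment t y₀ hb q.1) (𝓝 (embedMoment t y₀ hb p.1)),
      r < ∫ y, g y ∂(q.1 : Measure Y) := by
  obtain ⟨K, hK, hgK⟩ := exists_abs_le_of_mem_phiT ht y₀ hg
  let u : Y → ℝ := fun y => g y + K * (1 + dist y y₀ ^ t)
  have hu0 : ∀ y, 0 ≤ u y := fun y => by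
    have := neg_abs_le (g y); have := hgK y; simp only [u]; linarith
  have huc : Continuous u :=
    hg.1.add (continuous_const.mul (continuous_const.add (continuous_dist_rpow ht y₀)))
  have hint : ∀ q : ProbabilityMeasure Y, MemPt t q → ∫ y, u y ∂(q : Measure Y) =
      ∫ y, g y ∂(q : Measure Y) + K * (1 + (distMoment t y₀ (q : Measure Y)).toReal) := by
    intro q hq
    have hw : Integrable (fun y => K * (1 + dist y y₀ ^ t)) (q : Measure Y) :=
      ((integrable_const 1).add (hq.integrable ht y₀)).const_mul K
    rw [integral_add (hq.integrable_phiT ht hg) hw, integral_const_mul,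
      integral_add (integrable_const 1) (hq.integrable ht y₀), integral_dist_rpow_eq_distMoment ht]
    simp
  have hlint : ∀ q : ProbabilityMeasure Y, MemPt t q → ENNReal.ofReal (∫ y, u y ∂(q : Measure Y)) =
      ∫⁻ z, lscEnvelope b (ENNReal.ofReal ∘ u) z ∂((embedMoment t y₀ hb q).1 : Measure L) := by
    intro q hq
    rw [embedMoment, lintegral_lscEnvelope_map hb
      (ENNReal.continuous_ofReal.comp huc).lowerSemicontinuous,
      ofReal_integral_eq_lintegral_ofReal ?_ (Eventually.of_forall hu0)]
    · rfl
    · exact (hq.integrable_phiT ht hg).add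
        (((integrable_const 1).add (hq.integrable ht y₀)).const_mul K)
  set e := ∫ y, g y ∂(p.1 : Measure Y) - r with he
  have he0 : 0 < e := sub_pos.2 hr
  have h1 : ∀ᶠ q : PtSpace t Y in comap (fun q => embedMoment t y₀ hb q.1)
      (𝓝 (embedMoment t y₀ hb p.1)),
      K * (distMoment t y₀ (q.1 : Measure Y)).toReal <
        K * (distMoment t y₀ (p.1 : Measure Y)).toReal + e / 2 := by
    have : Tendsto (fun w : ProbabilityMeasure L × ℝ≥0∞ => K * w.2.toReal)
        (𝓝 (embedMoment t y₀ hb p.1)) (𝓝 (K * (distMoment t y₀ (p.1 : Measure Y)).toReal)) :=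
      ((ENNReal.tendsto_toReal ((memPt_iff_distMoment_ne_top ht y₀).1 p.2)).comp
        (continuous_snd.tendsto (embedMoment t y₀ hb p.1))).const_mul K
    exact (this.eventually_lt_const (lt_add_of_pos_right _ (half_pos he0))).comap _
  have h2 : ∀ᶠ q : PtSpace t Y in comap (fun q => embedMoment t y₀ hb q.1)
      (𝓝 (embedMoment t y₀ hb p.1)),
      ∫ y, u y ∂(p.1 : Measure Y) - e / 2 < ∫ y, u y ∂(q.1 : Measure Y) := by
    rcases lt_or_ge (∫ y, u y ∂(p.1 : Measure Y) - e / 2) 0 with hneg | hpos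
    · exact Eventually.of_forall fun q => hneg.trans_le (integral_nonneg hu0)
    have hlsc := (lowerSemicontinuous_lintegral (lowerSemicontinuous_lscEnvelope b
      (ENNReal.ofReal ∘ u))).comp
      (continuous_fst (X := ProbabilityMeasure L) (Y := ℝ≥0∞))
    have hlt : ENNReal.ofReal (∫ y, u y ∂(p.1 : Measure Y) - e / 2) <
        ENNReal.ofReal (∫ y, u y ∂(p.1 : Measure Y)) :=
      (ENNReal.ofReal_lt_ofReal_iff_of_nonneg hpos).2 (by linarith)
    replace hlt := hlt.trans_eq (hlint p.1 p.2)
    refine ((hlsc _ _ hlt).comap (fun q : PtSpace t Y => embedMoment t y₀ hb q.1)).mono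
      fun q hq => ?_
    simp only [Function.comp] at hq
    rw [← hlint q.1 q.2] at hq
    exact (ENNReal.ofReal_lt_ofReal_iff_of_nonneg hpos).1 hq
  filter_upwards [h1, h2] with q hq1 hq2
  rw [hint _ p.2, hint _ q.2] at hq2
  linarith

lemma comap_embedMoment_le_nhds {t : ℝ} (ht : 1 ≤ t) (y₀ : Y) {b : Y → L} (hb : IsEmbedding b)
    (p : PtSpace t Y) :
    comap (fun q : PtSpace t Y => embedMoment t y₀ hb q.1) (𝓝 (embedMoment t y₀ hb p.1)) ≤ 𝓝 p := by
  rw [nhds_iInf]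
  refine le_iInf fun g => ?_
  rw [nhds_iInf]
  refine le_iInf fun hg => ?_
  rw [nhds_induced, ← tendsto_iff_comap, tendsto_order]
  refine ⟨fun r hr => eventually_lt_integral_of_mem_phiT ht y₀ hb p hg hr, fun r hr => ?_⟩
  have hg' : (fun y => -g y) ∈ PhiT t Y := ⟨hg.1.neg, by simpa using hg.2⟩
  have := eventually_lt_integral_of_mem_phiT ht y₀ hb p hg' (r := -r) (by
    rw [integral_neg]; exact neg_lt_neg hr)
  filter_upwards [this] with q hq
  rw [integral_neg] at hq
  exact neg_lt_neg_iff.1 hq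

/-- The embedding of `X × 𝒫_t(Y)` into a compact space. -/
def embedPair (t : ℝ) (y₀ : Y) (a : X → K) {b : Y → L} (hb : IsEmbedding b)
    (z : X × PtSpace t Y) : K × ProbabilityMeasure L × ℝ≥0∞ :=
  (a z.1, embedMoment t y₀ hb z.2.1)

lemma comap_embedPair_le_nhds {t : ℝ} (ht : 1 ≤ t) (y₀ : Y) {a : X → K} (ha : IsEmbedding a)
    {b : Y → L} (hb : IsEmbedding b) (z : X × PtSpace t Y) :
    comap (embedPair t y₀ a hb) (𝓝 (embedPair t y₀ a hb z)) ≤ 𝓝 z := by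
  rw [embedPair, nhds_prod_eq (x := a z.1)]
  refine (Filter.prod_comap_comap_eq (m₁ := a)
    (m₂ := fun q : PtSpace t Y => embedMoment t y₀ hb q.1)).ge.trans ?_
  rw [show 𝓝 z = 𝓝 z.1 ×ˢ 𝓝 z.2 from nhds_prod_eq]
  exact Filter.prod_mono (ha.isInducing.nhds_eq_comap _).ge (comap_embedMoment_le_nhds ht y₀ hb z.2)

end Compactification

section Jensen

variable {X Y : Type*} [MetricSpace X] [MetricSpace Y] [MeasurableSpace Y] [BorelSpace Y]

lemma exists_finset_mem_nhds_ptSpace {t : ℝ} {p : PtSpace t Y} {U : Set (PtSpace t Y)}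
    (hU : U ∈ 𝓝 p) : ∃ (I : Finset (PhiT t Y)) (V : PhiT t Y → Set ℝ),
      (∀ g, V g ∈ 𝓝 (∫ y, g.1 y ∂(p.1 : Measure Y))) ∧
      ∀ q : PtSpace t Y, (∀ g ∈ I, ∫ y, g.1 y ∂(q.1 : Measure Y) ∈ V g) → q ∈ U := by
  let E : PtSpace t Y → PhiT t Y → ℝ := fun q g => ∫ y, g.1 y ∂(q.1 : Measure Y)
  have hE : 𝓝 p = comap E (𝓝 (E p)) := by
    rw [nhds_iInf, nhds_pi, Filter.pi, comap_iInf, iInf_subtype]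
    refine iInf_congr fun g => ?_
    rw [nhds_iInf]
    refine iInf_congr fun hg => ?_
    rw [nhds_induced, comap_comap]
    rfl
  rw [hE, mem_comap] at hU
  obtain ⟨S, hS, hSU⟩ := hU
  rw [nhds_pi] at hS
  obtain ⟨I, V, hV, hVS⟩ := mem_pi'.1 hS
  exact ⟨I, V, hV, fun q hq => hSU (hVS fun g hg => hq g hg)⟩

/-- The finitely many integrals and the cost bounds attained by the measures in `𝒫_t(Y)`. -/
def momentEpigraph (t : ℝ) (c : ProbabilityMeasure Y → ℝ≥0∞) (I : Finset (PhiT t Y)) :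
    Set ((I → ℝ) × ℝ) :=
  {v | 0 ≤ v.2 ∧ ∃ p : ProbabilityMeasure Y, MemPt t p ∧
    (∀ g : I, ∫ y, g.1.1 y ∂(p : Measure Y) = v.1 g) ∧ c p ≤ ENNReal.ofReal v.2}

lemma convex_momentEpigraph {t : ℝ} (ht : 1 ≤ t) {c : ProbabilityMeasure Y → ℝ≥0∞}
    (hconv : ∀ p q r : ProbabilityMeasure Y, MemPt t p → MemPt t q → ∀ a b : ℝ≥0, a + b = 1 →
      (r : Measure Y) = (a : ℝ≥0∞) • (p : Measure Y) + (b : ℝ≥0∞) • (q : Measure Y) →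
      c r ≤ (a : ℝ≥0∞) * c p + (b : ℝ≥0∞) * c q)
    (I : Finset (PhiT t Y)) : Convex ℝ (momentEpigraph t c I) := by
  rintro v ⟨hv, p, hp, hpv, hcp⟩ w ⟨hw, q, hq, hqw, hcq⟩ a b ha hb hab
  lift a to ℝ≥0 using ha
  lift b to ℝ≥0 using hb
  have hab' : a + b = 1 := by exact_mod_cast hab
  let r : ProbabilityMeasure Y := ⟨(a : ℝ≥0∞) • (p : Measure Y) + (b : ℝ≥0∞) • (q : Measure Y),
    ⟨by simpa using (by exact_mod_cast hab' : (a : ℝ≥0∞) + b = 1)⟩⟩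
  have hr : (r : Measure Y) = (a : ℝ≥0∞) • (p : Measure Y) + (b : ℝ≥0∞) • (q : Measure Y) := rfl
  refine ⟨?_, r, ?_, fun g => ?_, ?_⟩
  · have : 0 ≤ (a : ℝ) * v.2 + b * w.2 := by positivity
    simpa using this
  · obtain ⟨y₀, hy₀⟩ := id hp
    refine ⟨y₀, ?_⟩
    rw [hr]
    exact (hy₀.smul_measure ENNReal.coe_ne_top).add_measure
      ((hq.integrable ht y₀).smul_measure ENNReal.coe_ne_top)
  · rw [hr, integral_add_measure ((hp.integrable_phiT ht g.1.2).smul_measure ENNReal.coe_ne_top)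
      ((hq.integrable_phiT ht g.1.2).smul_measure ENNReal.coe_ne_top), integral_smul_measure,
      integral_smul_measure, hpv, hqw]
    simp
  · refine (hconv p q r hp hq a b hab' hr).trans ((add_le_add (mul_le_mul_right hcp _)
      (mul_le_mul_right hcq _)).trans_eq ?_)
    rw [← ENNReal.ofReal_coe_nnreal, ← ENNReal.ofReal_coe_nnreal, ← ENNReal.ofReal_mul a.coe_nonneg,
      ← ENNReal.ofReal_mul b.coe_nonneg, ← ENNReal.ofReal_add (by positivity) (by positivity)]
    simp

/-- Jensen's inequality for lower semicontinuous convex functions on `𝒫_t(Y)`. -/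
lemma le_lintegral_of_eq_comp {t : ℝ} (ht : 1 ≤ t) {c : ProbabilityMeasure Y → ℝ≥0∞}
    (hlsc : LowerSemicontinuous fun q : PtSpace t Y => c q.1)
    (hconv : ∀ p q r : ProbabilityMeasure Y, MemPt t p → MemPt t q → ∀ a b : ℝ≥0, a + b = 1 →
      (r : Measure Y) = (a : ℝ≥0∞) • (p : Measure Y) + (b : ℝ≥0∞) • (q : Measure Y) →
      c r ≤ (a : ℝ≥0∞) * c p + (b : ℝ≥0∞) * c q)
    {Ω : Type*} [MeasurableSpace Ω] (M : Measure Ω) [IsProbabilityMeasure M] (κ : Kernel Ω Y)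
    [IsMarkovKernel κ] {R : ProbabilityMeasure Y} (hR : (R : Measure Y) = κ ∘ₘ M) (hRt : MemPt t R)
    {f : Ω → ℝ≥0∞} (hf : Measurable f)
    (hfc : ∀ᵐ ω ∂M, c ⟨κ ω, inferInstance⟩ = f ω) : c R ≤ ∫⁻ ω, f ω ∂M := by
  by_contra! hlt
  have hfin : ∫⁻ ω, f ω ∂M ≠ ⊤ := hlt.ne_top
  obtain ⟨r, hfr, hrc⟩ := exists_between hlt
  obtain ⟨I, V, hV, hVU⟩ := exists_finset_mem_nhds_ptSpace (hlsc ⟨R, hRt⟩ r hrc)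
  have hint : ∀ g ∈ PhiT t Y, Integrable g (κ ∘ₘ M) := fun g hg =>
    hR ▸ hRt.integrable_phiT ht hg
  have hint' : ∀ g ∈ PhiT t Y, Integrable (fun ω => ∫ y, g y ∂κ ω) M := fun g hg => by
    have := hint g hg
    rw [Measure.comp_eq_comp_const_apply] at this
    simpa using this.integral_comp
  have hbar : ∀ g ∈ PhiT t Y, ∫ ω, ∫ y, g y ∂κ ω ∂M = ∫ y, g y ∂(R : Measure Y) := fun g hg => by
    have := hint g hg
    rw [Measure.comp_eq_comp_const_apply] at this
    rw [hR, Measure.comp_eq_comp_const_apply, Kernel.integral_comp this]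
    simp
  have hmem : ∀ᵐ ω ∂M, ((fun g : I => ∫ y, g.1.1 y ∂κ ω), (f ω).toReal) ∈
      closure (momentEpigraph t c I) := by
    obtain ⟨y₀, hy₀⟩ := id hRt
    rw [hR] at hy₀
    filter_upwards [hfc, ae_lt_top hf hfin, Measure.ae_integrable_of_integrable_comp hy₀]
      with ω h1 h2 h3
    refine subset_closure ⟨ENNReal.toReal_nonneg, ⟨κ ω, inferInstance⟩, ⟨y₀, h3⟩, fun g => rfl, ?_⟩
    rw [ENNReal.ofReal_toReal h2.ne]
    exact h1.le
  have hg : Integrable (fun ω => fun g : I => ∫ y, g.1.1 y ∂κ ω) M :=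
    Integrable.of_eval fun g => hint' _ g.1.2
  have hfi : Integrable (fun ω => (f ω).toReal) M :=
    integrable_toReal_of_lintegral_ne_top hf.aemeasurable hfin
  have hcl := (convex_momentEpigraph ht hconv I).closure.integral_mem isClosed_closure hmem
    (hg.prodMk hfi)
  rw [integral_pair hg hfi, integral_toReal hf.aemeasurable (ae_lt_top hf hfin)] at hcl
  have hnhds : (Set.univ.pi fun g : I => V g.1) ×ˢ Set.Iio r.toReal ∈
      𝓝 (∫ ω, (fun g : I => ∫ y, g.1.1 y ∂κ ω) ∂M, (∫⁻ ω, f ω ∂M).toReal) := by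
    refine prod_mem_nhds (set_pi_mem_nhds Set.finite_univ fun g _ => ?_)
      (Iio_mem_nhds ((ENNReal.toReal_lt_toReal hfin hrc.ne_top).2 hfr))
    rw [eval_integral fun g : I => hint' _ g.1.2, hbar _ g.1.2]
    exact hV g.1
  obtain ⟨v, ⟨hv1, hv2⟩, -, p, hp, hpv, hcp⟩ := mem_closure_iff_nhds.1 hcl _ hnhds
  have h1 : r < c p := hVU ⟨p, hp⟩ fun g hg => by
    have := hv1 ⟨g, hg⟩ (Set.mem_univ _)
    rwa [← hpv] at this
  exact (h1.trans_le hcp).not_ge (ENNReal.ofReal_le_of_le_toReal (le_of_lt hv2))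

end Jensen

section Relaxation

variable {X Y K L : Type*} [MetricSpace X] [PolishSpace X] [MeasurableSpace X] [BorelSpace X]
  [MetricSpace Y] [PolishSpace Y] [MeasurableSpace Y] [BorelSpace Y] [Nonempty Y]
  [TopologicalSpace K] [CompactSpace K] [MetrizableSpace K] [MeasurableSpace K] [BorelSpace K]
  [TopologicalSpace L] [CompactSpace L] [MetrizableSpace L] [MeasurableSpace L] [BorelSpace L]

/-- The lower semicontinuous extension of a cost to the compactification. -/
def relaxedCost (t : ℝ) (y₀ : Y) (a : X → K) {b : Y → L} (hb : IsEmbedding b)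
    (C : X → ProbabilityMeasure Y → ℝ≥0∞) : K × ProbabilityMeasure L × ℝ≥0∞ → ℝ≥0∞ :=
  lscEnvelope (embedPair t y₀ a hb) fun z : X × PtSpace t Y => C z.1 z.2.1

lemma relaxedCost_apply {t : ℝ} (ht : 1 ≤ t) (y₀ : Y) {a : X → K} (ha : IsEmbedding a)
    {b : Y → L} (hb : IsEmbedding b) {C : X → ProbabilityMeasure Y → ℝ≥0∞}
    (hlsc : LowerSemicontinuous fun q : X × PtSpace t Y => C q.1 q.2.1) (x : X)
    {p : ProbabilityMeasure Y} (hp : MemPt t p) :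
    relaxedCost t y₀ a hb C (a x, embedMoment t y₀ hb p) = C x p :=
  lscEnvelope_apply hlsc (a := ((x, ⟨p, hp⟩) : X × PtSpace t Y))
    (comap_embedPair_le_nhds ht y₀ ha hb _)

lemma lintegral_lscEnvelope_le_of_relaxedCost_ne_top {t : ℝ} (ht : 1 ≤ t) (y₀ : Y) {a : X → K}
    {b : Y → L} (hb : IsEmbedding b) {C : X → ProbabilityMeasure Y → ℝ≥0∞}
    {z : K × ProbabilityMeasure L × ℝ≥0∞} (hz : relaxedCost t y₀ a hb C z ≠ ⊤) :
    ∫⁻ l, lscEnvelope b (fun y => ENNReal.ofReal (dist y y₀ ^ t)) l ∂(z.2.1 : Measure L) ≤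
      z.2.2 := by
  have hcl : IsClosed {w : ProbabilityMeasure L × ℝ≥0∞ |
      ∫⁻ l, lscEnvelope b (fun y => ENNReal.ofReal (dist y y₀ ^ t)) l ∂(w.1 : Measure L) ≤ w.2} :=
    (lowerSemicontinuous_lintegral (lowerSemicontinuous_lscEnvelope b _)).isClosed_epigraph
  refine closure_minimal ?_ (hcl.preimage continuous_snd)
    (mem_closure_range_of_lscEnvelope_ne_top hz)
  rintro _ ⟨⟨x, p⟩, rfl⟩
  exact (lintegral_lscEnvelope_map hb
    (ENNReal.continuous_ofReal.comp (continuous_dist_rpow ht y₀)).lowerSemicontinuous p.1).le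

lemma weakValue_le_lintegral_relaxedCost {t : ℝ} (ht : 1 ≤ t) (y₀ : Y) {a : X → K}
    (ha : IsEmbedding a) {b : Y → L} (hb : IsEmbedding b) {C : X → ProbabilityMeasure Y → ℝ≥0∞}
    (hlsc : LowerSemicontinuous fun q : X × PtSpace t Y => C q.1 q.2.1)
    (hconv : ∀ x : X, ∀ p q r : ProbabilityMeasure Y, MemPt t p → MemPt t q →
      ∀ a b : ℝ≥0, a + b = 1 →
      (r : Measure Y) = (a : ℝ≥0∞) • (p : Measure Y) + (b : ℝ≥0∞) • (q : Measure Y) →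
      C x r ≤ (a : ℝ≥0∞) * C x p + (b : ℝ≥0∞) * C x q)
    (μ : ProbabilityMeasure X) (ν : ProbabilityMeasure Y) (hν : MemPt t ν)
    (P : Measure (K × ProbabilityMeasure L × ℝ≥0∞)) [IsProbabilityMeasure P]
    (hPX : P.map Prod.fst = (μ : Measure X).map a)
    (hPY : tautologicalKernel L ∘ₘ P.map (fun z => z.2.1) = (ν : Measure Y).map b)
    (hPs : ∫⁻ z, z.2.2 ∂P ≤ distMoment t y₀ (ν : Measure Y)) :
    weakValue C μ ν ≤ ∫⁻ z, relaxedCost t y₀ a hb C z ∂P := by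
  by_cases htop : ∫⁻ z, relaxedCost t y₀ a hb C z ∂P = ⊤
  · exact htop ▸ le_top
  have : PolishSpace K := by let := metrizableSpaceMetric K; infer_instance
  have : Nonempty (K × ProbabilityMeasure L × ℝ≥0∞) := P.nonempty_of_neZero
  have : Nonempty X := (μ : Measure X).nonempty_of_neZero
  have hae := ha.continuous.measurableEmbedding ha.injective
  have hbe := hb.continuous.measurableEmbedding hb.injective
  obtain ⟨kX, hkX, hkXa⟩ := hae.exists_measurable_extend measurable_id fun _ => ‹_›
  obtain ⟨kY, hkY, hkYb⟩ := hbe.exists_measurable_extend measurable_id fun _ => ‹_›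
  have hkXa' : ∀ x, kX (a x) = x := congrFun hkXa
  have hkYb' : ∀ y, kY (b y) = y := congrFun hkYb
  have hCm : Measurable (relaxedCost t y₀ a hb C) :=
    (lowerSemicontinuous_lscEnvelope _ _).measurable
  have hwm : Measurable (lscEnvelope b fun y => ENNReal.ofReal (dist y y₀ ^ t)) :=
    (lowerSemicontinuous_lscEnvelope _ _).measurable
  have hw : ∀ y, lscEnvelope b (fun y => ENNReal.ofReal (dist y y₀ ^ t)) (b y) =
      ENNReal.ofReal (dist y y₀ ^ t) := fun y => lscEnvelope_apply
    (ENNReal.continuous_ofReal.comp (continuous_dist_rpow ht y₀)).lowerSemicontinuous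
    (hb.isInducing.nhds_eq_comap y).ge
  have hνm := (memPt_iff_distMoment_ne_top ht y₀).1 hν
  have hrange_fst : ∀ᵐ z ∂P, z.1 ∈ Set.range a := by
    refine ae_of_ae_map measurable_fst.aemeasurable ?_
    rw [hPX]
    exact (ae_map_iff hae.measurable.aemeasurable hae.measurableSet_range).2
      (Eventually.of_forall Set.mem_range_self)
  have hrange_snd : ∀ᵐ z ∂P, ∀ᵐ l ∂(z.2.1 : Measure L), l ∈ Set.range b := by
    have : ∀ᵐ l ∂(tautologicalKernel L ∘ₘ P.map (fun z => z.2.1)), l ∈ Set.range b := by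
      rw [hPY]
      exact (ae_map_iff hbe.measurable.aemeasurable hbe.measurableSet_range).2
        (Eventually.of_forall Set.mem_range_self)
    exact ae_of_ae_map (f := fun z : K × ProbabilityMeasure L × ℝ≥0∞ => z.2.1)
      (p := fun Q => ∀ᵐ l ∂(Q : Measure L), l ∈ Set.range b) (by fun_prop)
      (Measure.ae_ae_of_ae_comp this)
  have hmoment : ∫⁻ z, ∫⁻ l, lscEnvelope b (fun y => ENNReal.ofReal (dist y y₀ ^ t)) l
      ∂(z.2.1 : Measure L) ∂P = distMoment t y₀ (ν : Measure Y) := by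
    have h := congrArg
      (fun m => ∫⁻ l, lscEnvelope b (fun y => ENNReal.ofReal (dist y y₀ ^ t)) l ∂m) hPY
    rw [Measure.lintegral_bind (Kernel.aemeasurable _) hwm.aemeasurable,
      lintegral_map hwm.lintegral_kernel (by fun_prop), lintegral_map hwm hbe.measurable] at h
    simp_rw [hw] at h
    exact h
  have heq : (fun z : K × ProbabilityMeasure L × ℝ≥0∞ => ∫⁻ l,
      lscEnvelope b (fun y => ENNReal.ofReal (dist y y₀ ^ t)) l ∂(z.2.1 : Measure L)) =ᵐ[P]
      fun z => z.2.2 := by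
    refine ae_eq_of_ae_le_of_lintegral_le ?_ (hmoment ▸ hνm) (by fun_prop) (hPs.trans hmoment.ge)
    filter_upwards [ae_lt_top hCm htop] with z hz
    exact lintegral_lscEnvelope_le_of_relaxedCost_ne_top ht y₀ hb hz.ne
  have hsfin : ∀ᵐ z ∂P, z.2.2 < ⊤ := ae_lt_top (by fun_prop) (ne_top_of_le_ne_top hνm hPs)
  let κ : Kernel (K × ProbabilityMeasure L × ℝ≥0∞) Y :=
    ((tautologicalKernel L).comap (fun z => z.2.1) (by fun_prop)).map kY
  have : IsMarkovKernel κ := Kernel.IsMarkovKernel.map _ hkY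
  have hκ : ∀ z, κ z = (z.2.1 : Measure L).map kY := fun z => by
    rw [Kernel.map_apply _ hkY, Kernel.comap_apply]; rfl
  have hcost : ∀ᵐ z ∂P, C (kX z.1) ⟨κ z, inferInstance⟩ = relaxedCost t y₀ a hb C z := by
    filter_upwards [hrange_fst, hrange_snd, heq, hsfin] with z h1 h2 h3 h4
    obtain ⟨x, hx⟩ := h1
    obtain ⟨q, hq⟩ : ∃ q : ProbabilityMeasure Y, q = ⟨κ z, inferInstance⟩ := ⟨_, rfl⟩
    have hqm : (q : Measure Y) = κ z := by rw [hq]; rfl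
    rw [← hq]
    have hmap : q.map hb.continuous.measurable.aemeasurable = z.2.1 := by
      refine ProbabilityMeasure.toMeasure_injective ?_
      rw [ProbabilityMeasure.toMeasure_map, hqm, hκ, Measure.map_map hbe.measurable hkY]
      conv_rhs => rw [← Measure.map_id (μ := (z.2.1 : Measure L))]
      refine Measure.map_congr ?_
      filter_upwards [h2] with l hl
      obtain ⟨y, rfl⟩ := hl
      simp [hkYb']
    have hmom : distMoment t y₀ (q : Measure Y) = z.2.2 := by
      rw [← h3, ← hmap]
      exact (lintegral_lscEnvelope_map hb (ENNReal.continuous_ofReal.comp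
        (continuous_dist_rpow ht y₀)).lowerSemicontinuous q).symm
    have hmem : MemPt t q :=
      (memPt_iff_distMoment_ne_top ht y₀).2 (hmom.trans_lt h4).ne
    rw [← relaxedCost_apply ht y₀ ha hb hlsc (kX z.1) hmem]
    congr 1
    refine Prod.ext ?_ (Prod.ext hmap hmom)
    simp [← hx, hkXa']
  let P' : Measure (X × K × ProbabilityMeasure L × ℝ≥0∞) := P.map fun z => (kX z.1, z)
  have hgm : Measurable fun z : K × ProbabilityMeasure L × ℝ≥0∞ => (kX z.1, z) := by fun_prop
  have : IsProbabilityMeasure P' := Measure.isProbabilityMeasure_map hgm.aemeasurable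
  have hfst : P'.fst = μ := by
    have : kX ∘ a = id := hkXa
    rw [Measure.fst, Measure.map_map measurable_fst hgm]
    change P.map (kX ∘ Prod.fst) = μ
    rw [← Measure.map_map hkX measurable_fst, hPX, Measure.map_map hkX hae.measurable, this,
      Measure.map_id]
  have hsnd : P'.snd = P := by
    rw [Measure.snd, Measure.map_map measurable_snd hgm]
    exact Measure.map_id
  let M := P'.condKernel
  have hM : (μ : Measure X) ⊗ₘ M = P' := hfst ▸ P'.disintegrate P'.condKernel
  have hcomp : (κ ∘ₖ M) ∘ₘ (μ : Measure X) = ν := by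
    have h1 : (tautologicalKernel L).comap (fun z : K × ProbabilityMeasure L × ℝ≥0∞ => z.2.1)
        (by fun_prop) ∘ₘ P = tautologicalKernel L ∘ₘ P.map (fun z => z.2.1) := by
      ext s hs
      rw [Measure.bind_apply hs (Kernel.aemeasurable _),
        Measure.bind_apply hs (Kernel.aemeasurable _),
        lintegral_map ((tautologicalKernel L).measurable_coe hs) (by fun_prop)]
      rfl
    have h2 : kY ∘ b = id := hkYb
    rw [← Measure.comp_assoc, ← Measure.snd_compProd (μ : Measure X) M, hM, hsnd,
      ← Measure.map_comp _ _ hkY, h1, hPY,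
      Measure.map_map hkY hbe.measurable, h2, Measure.map_id]
  let π : ProbabilityMeasure (X × Y) := ⟨(μ : Measure X) ⊗ₘ (κ ∘ₖ M), inferInstance⟩
  have hπ : (π : Measure (X × Y)) = (μ : Measure X) ⊗ₘ (κ ∘ₖ M) := rfl
  have hπfst : (π : Measure (X × Y)).fst = μ := by rw [hπ, Measure.fst_compProd]
  have hcoup : IsCoupling μ ν π := ⟨hπfst, by
    rw [← hcomp, ← Measure.snd_compProd, hπ]; rfl⟩
  refine (iInf₂_le π hcoup).trans ?_
  have hint : ∫⁻ x, ∫⁻ z, relaxedCost t y₀ a hb C z ∂(M x) ∂(μ : Measure X) =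
      ∫⁻ z, relaxedCost t y₀ a hb C z ∂P := by
    rw [← hsnd, Measure.snd, lintegral_map hCm measurable_snd, ← hM]
    exact (Measure.lintegral_compProd (hCm.comp measurable_snd)).symm
  rw [← hint]
  have hdis : ∀ᵐ x ∂(μ : Measure X), (κ ∘ₖ M) x = (π : Measure (X × Y)).condKernel x := by
    have := eq_condKernel_of_measure_eq_compProd (ρ := (π : Measure (X × Y))) (κ ∘ₖ M) (by
      rw [hπfst, hπ])
    rwa [hπfst] at this
  have hmemR : ∀ᵐ x ∂(μ : Measure X), Integrable (fun y => dist y y₀ ^ t) ((κ ∘ₖ M) x) :=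
    Measure.ae_integrable_of_integrable_comp (hcomp ▸ hν.integrable ht y₀)
  have hcostM : ∀ᵐ x ∂(μ : Measure X), ∀ᵐ z ∂(M x),
      C x ⟨κ z, inferInstance⟩ = relaxedCost t y₀ a hb C z := by
    obtain ⟨N, hN, hNm, hPN⟩ := exists_measurable_superset_of_null (ae_iff.1 hcost)
    have hae' : ∀ᵐ w ∂P', w.2 ∉ N ∧ kX w.2.1 = w.1 := by
      refine (ae_map_iff hgm.aemeasurable ?_).2 ?_
      · exact (measurable_snd hNm.compl).inter (measurableSet_eq_fun (by fun_prop) measurable_fst)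
      · filter_upwards [measure_eq_zero_iff_ae_notMem.1 hPN] with z hz using ⟨hz, rfl⟩
    rw [← hM] at hae'
    filter_upwards [Measure.ae_ae_of_ae_compProd hae'] with x hx
    filter_upwards [hx] with z hz
    have := not_not.1 fun h => hz.1 (hN h)
    rwa [hz.2] at this
  refine lintegral_mono_ae ?_
  filter_upwards [hdis, hmemR, hcostM] with x h1 h2 h3
  refine le_lintegral_of_eq_comp ht ?_ (hconv x) (M x) κ ?_ ?_ hCm h3
  · intro p r hr
    have hc : Continuous fun p : PtSpace t Y => (x, p) := by fun_prop
    exact (hc.tendsto p).eventually (hlsc (x, p) r hr)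
  · exact h1.symm.trans (Kernel.comp_apply _ _ _)
  · refine ⟨y₀, ?_⟩
    change Integrable _ ((π : Measure (X × Y)).condKernel x)
    rwa [← h1]

end Relaxation

section Duality

lemma integrable_integral_comp {α β : Type*} [MeasurableSpace α] [MeasurableSpace β]
    {κ : Kernel α β} [IsMarkovKernel κ] {μ : Measure α} [IsFiniteMeasure μ] {g : β → ℝ}
    (hg : Integrable g (κ ∘ₘ μ)) :
    Integrable (fun x => ∫ y, g y ∂(κ x)) μ ∧
      ∫ y, g y ∂(κ ∘ₘ μ) = ∫ x, ∫ y, g y ∂(κ x) ∂μ := by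
  rw [Measure.comp_eq_comp_const_apply] at hg ⊢
  exact ⟨by simpa using hg.integral_comp, by rw [Kernel.integral_comp hg, Kernel.const_apply]⟩

variable {X Y K L : Type*} [MetricSpace X] [PolishSpace X] [MeasurableSpace X] [BorelSpace X]
  [MetricSpace Y] [PolishSpace Y] [MeasurableSpace Y] [BorelSpace Y] [Nonempty Y]
  [TopologicalSpace K] [CompactSpace K] [MetrizableSpace K] [MeasurableSpace K] [BorelSpace K]
  [TopologicalSpace L] [CompactSpace L] [MetrizableSpace L] [MeasurableSpace L] [BorelSpace L]

lemma integrable_continuousMap (g : C(K, ℝ)) (P : Measure K) [IsFiniteMeasure P] :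
    Integrable g P :=
  g.continuous.integrable_of_hasCompactSupport (HasCompactSupport.of_compactSpace g)

/-- The defect of a pair of test functions against prescribed marginals. -/
def marginalDefect (μ : Measure K) (ν : Measure L) [IsFiniteMeasure μ] [IsFiniteMeasure ν] :
    C(K, ℝ) × C(L, ℝ) →ₗ[ℝ] C(K × ProbabilityMeasure L × ℝ≥0∞, ℝ) where
  toFun m := ⟨fun z => (m.1 z.1 - ∫ x, m.1 x ∂μ) +
      (∫ y, m.2 y ∂(z.2.1 : Measure L) - ∫ y, m.2 y ∂ν), by
    have := (continuous_integral_continuousMap m.2).comp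
      (continuous_fst.comp continuous_snd :
        Continuous fun z : K × ProbabilityMeasure L × ℝ≥0∞ => z.2.1)
    exact ((m.1.continuous.comp continuous_fst).sub continuous_const).add
      (this.sub continuous_const)⟩
  map_add' m n := by
    ext z
    simp only [Prod.fst_add, Prod.snd_add, ContinuousMap.coe_mk, ContinuousMap.add_apply]
    rw [integral_add (integrable_continuousMap _ _) (integrable_continuousMap _ _),
      integral_add (integrable_continuousMap _ _) (integrable_continuousMap _ _),
      integral_add (integrable_continuousMap _ _) (integrable_continuousMap _ _)]
    ring
  map_smul' c m := by
    ext z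
    simp only [Prod.smul_fst, Prod.smul_snd, ContinuousMap.coe_mk, ContinuousMap.smul_apply,
      smul_eq_mul, integral_const_mul, RingHom.id_apply]
    ring

lemma marginalDefect_apply (μ : Measure K) (ν : Measure L) [IsFiniteMeasure μ] [IsFiniteMeasure ν]
    (m : C(K, ℝ) × C(L, ℝ)) (z : K × ProbabilityMeasure L × ℝ≥0∞) :
    marginalDefect μ ν m z = (m.1 z.1 - ∫ x, m.1 x ∂μ) +
      (∫ y, m.2 y ∂(z.2.1 : Measure L) - ∫ y, m.2 y ∂ν) := rfl

lemma marginals_eq_of_integral_marginalDefect_eq_zero {μ : Measure K} {ν : Measure L}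
    [IsProbabilityMeasure μ] [IsProbabilityMeasure ν]
    {P : Measure (K × ProbabilityMeasure L × ℝ≥0∞)} [IsProbabilityMeasure P]
    (h : ∀ m, ∫ z, marginalDefect μ ν m z ∂P = 0) :
    P.map Prod.fst = μ ∧ tautologicalKernel L ∘ₘ P.map (fun z => z.2.1) = ν := by
  have hm : Measurable fun z : K × ProbabilityMeasure L × ℝ≥0∞ => z.2.1 := by fun_prop
  have : IsProbabilityMeasure (P.map Prod.fst) :=
    Measure.isProbabilityMeasure_map measurable_fst.aemeasurable
  have : IsProbabilityMeasure (P.map fun z : K × ProbabilityMeasure L × ℝ≥0∞ => z.2.1) :=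
    Measure.isProbabilityMeasure_map hm.aemeasurable
  constructor
  · refine ext_of_forall_continuousMap_integral_eq fun f => ?_
    have := h (f, 0)
    simp only [marginalDefect_apply, ContinuousMap.zero_apply, integral_zero, sub_zero,
      add_zero] at this
    rw [integral_sub (f := fun z : K × ProbabilityMeasure L × ℝ≥0∞ => f z.1)
      ((integrable_continuousMap f (P.map Prod.fst)).comp_measurable measurable_fst)
      (integrable_const _), sub_eq_zero] at this
    rw [integral_map measurable_fst.aemeasurable f.continuous.aestronglyMeasurable, this]
    simp
  · refine ext_of_forall_continuousMap_integral_eq fun g => ?_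
    have := h (0, g)
    have hc := (continuous_integral_continuousMap g)
    simp only [marginalDefect_apply, ContinuousMap.zero_apply, integral_zero, sub_zero,
      zero_add] at this
    have hi : Integrable (fun q : ProbabilityMeasure L => ∫ y, g y ∂(q : Measure L))
        (P.map fun z : K × ProbabilityMeasure L × ℝ≥0∞ => z.2.1) :=
      integrable_continuousMap ⟨_, hc⟩ _
    rw [integral_sub
      (f := fun z : K × ProbabilityMeasure L × ℝ≥0∞ => ∫ y, g y ∂(z.2.1 : Measure L))
      (hi.comp_measurable hm) (integrable_const _), sub_eq_zero] at this
    rw [(integrable_integral_comp (integrable_continuousMap g _)).2]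
    change ∫ q : ProbabilityMeasure L, ∫ y, g y ∂(q : Measure L) ∂_ = _
    rw [integral_map hm.aemeasurable hc.aestronglyMeasurable, this]
    simp

lemma exists_multiplier_of_lt_weakValue {t : ℝ} (ht : 1 ≤ t) (y₀ : Y) {a : X → K}
    (ha : IsEmbedding a) {b : Y → L} (hb : IsEmbedding b) {C : X → ProbabilityMeasure Y → ℝ≥0∞}
    (hlsc : LowerSemicontinuous fun q : X × PtSpace t Y => C q.1 q.2.1)
    (hconv : ∀ x : X, ∀ p q r : ProbabilityMeasure Y, MemPt t p → MemPt t q →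
      ∀ a b : ℝ≥0, a + b = 1 →
      (r : Measure Y) = (a : ℝ≥0∞) • (p : Measure Y) + (b : ℝ≥0∞) • (q : Measure Y) →
      C x r ≤ (a : ℝ≥0∞) * C x p + (b : ℝ≥0∞) * C x q)
    (μ : ProbabilityMeasure X) (ν : ProbabilityMeasure Y) (hν : MemPt t ν) {r : ℝ}
    (hr : 0 ≤ r → ENNReal.ofReal r < weakValue C μ ν) :
    ∃ (f : C(K, ℝ)) (g : C(L, ℝ)) (l l₀ δ : ℝ), 0 ≤ l ∧ 0 ≤ l₀ ∧ 0 < δ ∧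
      ∀ x p, MemPt t p → C x p ≠ ⊤ → δ ≤ (f (a x) - ∫ x, f (a x) ∂(μ : Measure X)) +
        (∫ y, g (b y) ∂(p : Measure Y) - ∫ y, g (b y) ∂(ν : Measure Y)) +
        l * (∫ y, dist y y₀ ^ t ∂(p : Measure Y) - ∫ y, dist y y₀ ^ t ∂(ν : Measure Y)) +
        l₀ * ((C x p).toReal - r) := by
  have ham := ha.continuous.measurable
  have hbm := hb.continuous.measurable
  have : IsProbabilityMeasure ((μ : Measure X).map a) :=
    Measure.isProbabilityMeasure_map ham.aemeasurable
  have : IsProbabilityMeasure ((ν : Measure Y).map b) :=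
    Measure.isProbabilityMeasure_map hbm.aemeasurable
  obtain ⟨⟨f, g⟩, l, l₀, δ, hl, hl₀, hδ, h⟩ := exists_multiplier_of_infeasible
    (marginalDefect ((μ : Measure X).map a) ((ν : Measure Y).map b))
    (s := fun z => z.2.2) (c := relaxedCost t y₀ a hb C)
    (continuous_snd.comp continuous_snd).lowerSemicontinuous (lowerSemicontinuous_lscEnvelope _ _)
    (S := (distMoment t y₀ (ν : Measure Y)).toReal) (r := r) (by
      rintro ⟨-, hr0, P, hP, hPs, hPc⟩
      obtain ⟨h1, h2⟩ := marginals_eq_of_integral_marginalDefect_eq_zero hP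
      rw [ENNReal.ofReal_toReal ((memPt_iff_distMoment_ne_top ht y₀).1 hν)] at hPs
      exact ((weakValue_le_lintegral_relaxedCost ht y₀ ha hb hlsc hconv μ ν hν _ h1 h2 hPs).trans
        hPc).not_gt (hr hr0))
  refine ⟨f, g, l, l₀, δ, hl, hl₀, hδ, fun x p hp hC => ?_⟩
  have hC' := relaxedCost_apply ht y₀ ha hb hlsc x hp
  have := h (a x, embedMoment t y₀ hb p) ((memPt_iff_distMoment_ne_top ht y₀).1 hp) (hC' ▸ hC)
  rw [hC', marginalDefect_apply, integral_map ham.aemeasurable f.continuous.aestronglyMeasurable,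
    integral_map hbm.aemeasurable g.continuous.aestronglyMeasurable] at this
  rw [integral_dist_rpow_eq_distMoment ht, integral_dist_rpow_eq_distMoment ht]
  rwa [embedMoment, ProbabilityMeasure.toMeasure_map, integral_map hbm.aemeasurable
    g.continuous.aestronglyMeasurable] at this

end Duality

section Potentials

variable {X Y K L : Type*} [MetricSpace X] [PolishSpace X] [MeasurableSpace X] [BorelSpace X]
  [MetricSpace Y] [PolishSpace Y] [MeasurableSpace Y] [BorelSpace Y] [Nonempty Y]
  [TopologicalSpace K] [CompactSpace K] [MetrizableSpace K] [MeasurableSpace K] [BorelSpace K]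
  [TopologicalSpace L] [CompactSpace L] [MetrizableSpace L] [MeasurableSpace L] [BorelSpace L]

lemma IsCoupling.condKernel_comp {μ : ProbabilityMeasure X} {ν : ProbabilityMeasure Y}
    {π : ProbabilityMeasure (X × Y)} (hπ : IsCoupling μ ν π) :
    (π : Measure (X × Y)).condKernel ∘ₘ (μ : Measure X) = ν := by
  have h : (π : Measure (X × Y)).fst = μ := hπ.1
  rw [← Measure.snd_compProd, ← h, Measure.disintegrate]
  exact hπ.2

lemma IsCoupling.ae_memPt {t : ℝ} (ht : 1 ≤ t) {μ : ProbabilityMeasure X} {ν : ProbabilityMeasure Y}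
    {π : ProbabilityMeasure (X × Y)} (hπ : IsCoupling μ ν π) (hν : MemPt t ν) :
    ∀ᵐ x ∂(μ : Measure X), MemPt t (disint π x) := by
  obtain ⟨y₀⟩ := ‹Nonempty Y›
  have := hν.integrable ht y₀
  rw [← hπ.condKernel_comp] at this
  filter_upwards [Measure.ae_integrable_of_integrable_comp this] with x hx using ⟨y₀, hx⟩

lemma IsCoupling.integrable_integral_disint {μ : ProbabilityMeasure X} {ν : ProbabilityMeasure Y}
    {π : ProbabilityMeasure (X × Y)} (hπ : IsCoupling μ ν π) {g : Y → ℝ}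
    (hg : Integrable g (ν : Measure Y)) :
    Integrable (fun x => ∫ y, g y ∂(disint π x : Measure Y)) (μ : Measure X) ∧
      ∫ x, ∫ y, g y ∂(disint π x : Measure Y) ∂(μ : Measure X) = ∫ y, g y ∂(ν : Measure Y) := by
  rw [← hπ.condKernel_comp] at hg ⊢
  exact ⟨(integrable_integral_comp hg).1, (integrable_integral_comp hg).2.symm⟩

lemma measurable_embedMoment_disint {t : ℝ} (ht : 1 ≤ t) (y₀ : Y) {b : Y → L} (hb : IsEmbedding b)
    (π : ProbabilityMeasure (X × Y)) : Measurable fun x => embedMoment t y₀ hb (disint π x) := by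
  refine Measurable.prodMk ?_ ?_
  · exact ((Measure.measurable_map b hb.continuous.measurable).comp
      (π : Measure (X × Y)).condKernel.measurable).subtype_mk
  · exact Measurable.lintegral_kernel
      (continuous_dist_rpow ht y₀).measurable.ennreal_ofReal

lemma aemeasurable_cost_disint {t : ℝ} (ht : 1 ≤ t) {C : X → ProbabilityMeasure Y → ℝ≥0∞}
    {a : X → K} (ha : IsEmbedding a) {b : Y → L} (hb : IsEmbedding b)
    (hlsc : LowerSemicontinuous fun q : X × PtSpace t Y => C q.1 q.2.1)
    {μ : ProbabilityMeasure X} {ν : ProbabilityMeasure Y} (hν : MemPt t ν)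
    {π : ProbabilityMeasure (X × Y)} (hπ : IsCoupling μ ν π) :
    AEMeasurable (fun x => C x (disint π x)) (μ : Measure X) := by
  obtain ⟨y₀⟩ := id ‹Nonempty Y›
  refine ⟨fun x => relaxedCost t y₀ a hb C (a x, embedMoment t y₀ hb (disint π x)),
    (lowerSemicontinuous_lscEnvelope _ _).measurable.comp
      (ha.continuous.measurable.prodMk (measurable_embedMoment_disint ht y₀ hb π)), ?_⟩
  filter_upwards [hπ.ae_memPt ht hν] with x hx using (relaxedCost_apply ht y₀ ha hb hlsc x hx).symm

/-- Almost optimal dual potentials: their gap is nonnegative and has small integral along the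
disintegration of an optimal coupling. -/
lemma exists_potentials {t : ℝ} (ht : 1 ≤ t) {C : X → ProbabilityMeasure Y → ℝ≥0∞}
    {a : X → K} (ha : IsEmbedding a) {b : Y → L} (hb : IsEmbedding b)
    (hlsc : LowerSemicontinuous fun q : X × PtSpace t Y => C q.1 q.2.1)
    (hconv : ∀ x : X, ∀ p q r : ProbabilityMeasure Y, MemPt t p → MemPt t q →
      ∀ a b : ℝ≥0, a + b = 1 →
      (r : Measure Y) = (a : ℝ≥0∞) • (p : Measure Y) + (b : ℝ≥0∞) • (q : Measure Y) →
      C x r ≤ (a : ℝ≥0∞) * C x p + (b : ℝ≥0∞) * C x q)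
    {μ : ProbabilityMeasure X} {ν : ProbabilityMeasure Y} (hν : MemPt t ν)
    (hfin : weakValue C μ ν ≠ ⊤) {π : ProbabilityMeasure (X × Y)} (hπ : IsCoupling μ ν π)
    (hopt : weakCost C μ π = weakValue C μ ν) {ε : ℝ} (hε : 0 < ε) :
    ∃ (F : X → ℝ) (G : Y → ℝ),
      (∀ p : ProbabilityMeasure Y, MemPt t p → Integrable G (p : Measure Y)) ∧
      (∀ x p, MemPt t p → C x p ≠ ⊤ → 0 ≤ (C x p).toReal + F x + ∫ y, G y ∂(p : Measure Y)) ∧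
      AEMeasurable (fun x => ENNReal.ofReal ((C x (disint π x)).toReal + F x +
        ∫ y, G y ∂(disint π x : Measure Y))) (μ : Measure X) ∧
      ∫⁻ x, ENNReal.ofReal ((C x (disint π x)).toReal + F x +
        ∫ y, G y ∂(disint π x : Measure Y)) ∂(μ : Measure X) ≤ ENNReal.ofReal ε := by
  obtain ⟨y₀⟩ := id ‹Nonempty Y›
  have hCm := aemeasurable_cost_disint ht ha hb hlsc hν hπ
  have hCfin : ∫⁻ x, C x (disint π x) ∂(μ : Measure X) ≠ ⊤ := fun h => hfin (hopt ▸ h)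
  have hCtop := ae_lt_top' hCm hCfin
  have hCi : Integrable (fun x => (C x (disint π x)).toReal) (μ : Measure X) :=
    integrable_toReal_of_lintegral_ne_top hCm hCfin
  have hCint : ∫ x, (C x (disint π x)).toReal ∂(μ : Measure X) = (weakValue C μ ν).toReal := by
    rw [integral_toReal hCm hCtop, ← hopt]; rfl
  set r := (weakValue C μ ν).toReal - ε with hrdef
  obtain ⟨f, g, l, l₀, δ, hl, hl₀, hδ, h⟩ := exists_multiplier_of_lt_weakValue ht y₀ ha hb hlsc
    hconv μ ν hν (r := r) (fun hr => by
      rw [ENNReal.ofReal_lt_iff_lt_toReal hr hfin]; linarith)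
  have hgi : ∀ p : ProbabilityMeasure Y, Integrable (fun y => g (b y)) (p : Measure Y) := fun p =>
    (integrable_continuousMap g ((p : Measure Y).map b)).comp_measurable hb.continuous.measurable
  have hfi : Integrable (fun x => f (a x)) (μ : Measure X) :=
    (integrable_continuousMap f ((μ : Measure X).map a)).comp_measurable ha.continuous.measurable
  obtain ⟨hg1, hg2⟩ := hπ.integrable_integral_disint (hgi ν)
  obtain ⟨hd1, hd2⟩ := hπ.integrable_integral_disint (hν.integrable ht y₀)
  set A := ∫ x, f (a x) ∂(μ : Measure X)
  set B := ∫ y, g (b y) ∂(ν : Measure Y)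
  set D := ∫ y, dist y y₀ ^ t ∂(ν : Measure Y)
  set u : X → ProbabilityMeasure Y → ℝ := fun x p => (f (a x) - A) +
    (∫ y, g (b y) ∂(p : Measure Y) - B) + l * (∫ y, dist y y₀ ^ t ∂(p : Measure Y) - D) +
    l₀ * ((C x p).toReal - r) with hu
  have i1 := hfi.sub (integrable_const A)
  have i2 := hg1.sub (integrable_const B)
  have i3 := (hd1.sub (integrable_const D)).const_mul l
  have i4 := (hCi.sub (integrable_const r)).const_mul l₀
  have hui : Integrable (fun x => u x (disint π x)) (μ : Measure X) := ((i1.add i2).add i3).add i4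
  have huint : ∫ x, u x (disint π x) ∂(μ : Measure X) = l₀ * ε := by
    refine (integral_add ((i1.add i2).add i3) i4).trans ?_
    have e1 := integral_sub hfi (integrable_const A)
    have e2 := integral_sub hg1 (integrable_const B)
    have e3 := integral_sub hd1 (integrable_const D)
    have e4 := integral_sub hCi (integrable_const r)
    have e5 := integral_add (i1.add i2) i3
    have e6 := integral_add i1 i2
    have e7 := integral_const_mul (μ := (μ : Measure X)) l
      (fun x => ∫ y, dist y y₀ ^ t ∂(disint π x : Measure Y) - D)
    have e8 := integral_const_mul (μ := (μ : Measure X)) l₀ (fun x => (C x (disint π x)).toReal - r)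
    simp only [Pi.add_apply, Pi.sub_apply] at *
    rw [e5, e6, e7, e8, e1, e2, e3, e4, hg2, hd2, hCint]
    simp [hrdef, A]
  have hδu : δ ≤ l₀ * ε := by
    rw [← huint]
    have : ∫ _, δ ∂(μ : Measure X) ≤ ∫ x, u x (disint π x) ∂(μ : Measure X) :=
      integral_mono_ae (integrable_const δ) hui (by
        filter_upwards [hCtop, hπ.ae_memPt ht hν] with x h1 h2 using h x _ h2 h1.ne)
    simpa using this
  have hl₀' : 0 < l₀ := pos_of_mul_pos_left (hδ.trans_le hδu) hε.le
  have hGi : ∀ p : ProbabilityMeasure Y, MemPt t p →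
      Integrable (fun y => g (b y) + l * dist y y₀ ^ t) (p : Measure Y) := fun p hp =>
    (hgi p).add ((hp.integrable ht y₀).const_mul l)
  have hφ : ∀ x p, MemPt t p → (C x p).toReal + ((f (a x) - A - B - l * D) / l₀ - r) +
      ∫ y, (g (b y) + l * dist y y₀ ^ t) / l₀ ∂(p : Measure Y) = u x p / l₀ := by
    intro x p hp
    rw [integral_div, integral_add (hgi p) ((hp.integrable ht y₀).const_mul l), integral_const_mul]
    simp only [hu]
    field_simp
    ring
  have hae : (fun x => ENNReal.ofReal (u x (disint π x) / l₀)) =ᵐ[(μ : Measure X)]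
      fun x => ENNReal.ofReal ((C x (disint π x)).toReal + ((f (a x) - A - B - l * D) / l₀ - r) +
        ∫ y, (g (b y) + l * dist y y₀ ^ t) / l₀ ∂(disint π x : Measure Y)) := by
    filter_upwards [hπ.ae_memPt ht hν] with x hx
    rw [hφ x _ hx]
  refine ⟨fun x => (f (a x) - A - B - l * D) / l₀ - r, fun y => (g (b y) + l * dist y y₀ ^ t) / l₀,
    fun p hp => (hGi p hp).div_const _, fun x p hp hC => ?_, ?_, ?_⟩
  · rw [hφ x p hp]
    exact div_nonneg (hδ.le.trans (h x p hp hC)) hl₀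
  · exact ((hui.div_const l₀).aemeasurable.ennreal_ofReal).congr hae
  · rw [← lintegral_congr_ae hae, ← ofReal_integral_eq_lintegral_ofReal (hui.div_const l₀),
      integral_div, huint, mul_div_cancel_left₀ _ hl₀'.ne']
    filter_upwards [hCtop, hπ.ae_memPt ht hν] with x h1 h2
    exact div_nonneg (hδ.le.trans (h x _ h2 h1.ne)) hl₀

end Potentials

section Monotone

variable {X Y : Type*} [MetricSpace Y] [MeasurableSpace Y]

/-- The points at which a sequence of dual gaps converges to zero form a monotone set. -/
lemma cMonotone_of_tendsto_zero {t : ℝ} {C : X → ProbabilityMeasure Y → ℝ≥0∞}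
    {F : ℕ → X → ℝ} {G : ℕ → Y → ℝ}
    (hG : ∀ n, ∀ p : ProbabilityMeasure Y, MemPt t p → Integrable (G n) (p : Measure Y))
    (h0 : ∀ n x p, MemPt t p → C x p ≠ ⊤ →
      0 ≤ (C x p).toReal + F n x + ∫ y, G n y ∂(p : Measure Y)) :
    ∀ (N : ℕ) (x : Fin N → X) (p q : Fin N → ProbabilityMeasure Y),
      (∀ k, MemPt t (p k) ∧ C (x k) (p k) ≠ ⊤ ∧
        Tendsto (fun n => (C (x k) (p k)).toReal + F n (x k) +
        ∫ y, G n y ∂(p k : Measure Y)) atTop (𝓝 0)) →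
      (∀ k, MemPt t (q k)) → (∑ k, (p k : Measure Y) = ∑ k, (q k : Measure Y)) →
      ∑ k, C (x k) (p k) ≤ ∑ k, C (x k) (q k) := by
  intro N x p q hp hq hpq
  by_cases hC : ∃ k, C (x k) (q k) = ⊤
  · exact le_top.trans_eq (ENNReal.sum_eq_top.2 (by simpa using hC)).symm
  push Not at hC
  have hint : ∀ n, ∑ k, ∫ y, G n y ∂(p k : Measure Y) = ∑ k, ∫ y, G n y ∂(q k : Measure Y) := by
    intro n
    rw [← integral_finsetSum_measure fun k _ => hG n _ (hp k).1, hpq,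
      integral_finsetSum_measure fun k _ => hG n _ (hq k)]
  have hle : ∀ n, ∑ k, (C (x k) (p k)).toReal - ∑ k, (C (x k) (q k)).toReal ≤
      ∑ k, ((C (x k) (p k)).toReal + F n (x k) + ∫ y, G n y ∂(p k : Measure Y)) := by
    intro n
    have := Finset.sum_nonneg fun k (_ : k ∈ Finset.univ) => h0 n (x k) (q k) (hq k) (hC k)
    simp only [Finset.sum_add_distrib] at this ⊢
    linarith [hint n]
  have hlim := tendsto_finsetSum Finset.univ fun k _ => (hp k).2.2
  rw [Finset.sum_const_zero] at hlim
  have := ge_of_tendsto' hlim hle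
  rw [← ENNReal.toReal_le_toReal (ENNReal.sum_ne_top.2 fun k _ => (hp k).2.1)
    (ENNReal.sum_ne_top.2 fun k _ => hC k), ENNReal.toReal_sum fun k _ => (hp k).2.1,
    ENNReal.toReal_sum fun k _ => hC k]
  linarith

end Monotone

lemma ae_tendsto_zero_of_lintegral_ofReal_le {α : Type*} [MeasurableSpace α] {μ : Measure α}
    {φ : ℕ → α → ℝ} (hm : ∀ n, AEMeasurable (fun x => ENNReal.ofReal (φ n x)) μ)
    (h : ∀ n, ∫⁻ x, ENNReal.ofReal (φ n x) ∂μ ≤ ENNReal.ofReal ((1 / 2) ^ n))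
    (h0 : ∀ᵐ x ∂μ, ∀ n, 0 ≤ φ n x) : ∀ᵐ x ∂μ, Tendsto (fun n => φ n x) atTop (𝓝 0) := by
  have hsum : ∫⁻ x, ∑' n, ENNReal.ofReal (φ n x) ∂μ ≠ ⊤ := by
    rw [lintegral_tsum hm]
    exact ne_top_of_le_ne_top (summable_geometric_two.tsum_ofReal_ne_top) (ENNReal.tsum_le_tsum h)
  filter_upwards [ae_lt_top' (AEMeasurable.tsum hm) hsum, h0] with x hx hx0
  have := (ENNReal.tendsto_toReal ENNReal.zero_ne_top).comp
    (ENNReal.tendsto_atTop_zero_of_tsum_ne_top hx.ne)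
  refine Tendsto.congr (fun n => ?_) this
  exact ENNReal.toReal_ofReal (hx0 n)

end Auxiliary

/-- Any optimizer of a finitely valued weak transport problem is `C`-monotone. -/
theorem weak_transport_optimizer_cMonotone
    (t : ℝ) (ht : 1 ≤ t) (C : X → ProbabilityMeasure Y → ℝ≥0∞)
    (hlsc : LowerSemicontinuous fun q : X × PtSpace t Y => C q.1 q.2.1)
    (hconv : ∀ x : X, ∀ p q r : ProbabilityMeasure Y, MemPt t p → MemPt t q →
      ∀ a b : ℝ≥0, a + b = 1 →
      (r : Measure Y) = (a : ℝ≥0∞) • (p : Measure Y) + (b : ℝ≥0∞) • (q : Measure Y) →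
      C x r ≤ (a : ℝ≥0∞) * C x p + (b : ℝ≥0∞) * C x q)
    (μ : ProbabilityMeasure X) (ν : ProbabilityMeasure Y) (hν : MemPt t ν)
    (hfin : weakValue C μ ν ≠ ⊤)
    (π : ProbabilityMeasure (X × Y)) (hπ : IsCoupling μ ν π)
    (hopt : weakCost C μ π = weakValue C μ ν) :
    ∃ Γ : Set (X × ProbabilityMeasure Y),
      (∀ xp ∈ Γ, MemPt t xp.2) ∧ CMonotone t C Γ ∧
        ∀ᵐ x ∂(μ : Measure X), (x, disint π x) ∈ Γ := by
  obtain ⟨a, ha⟩ := Metric.PiNatEmbed.exists_embedding_to_hilbert_cube (X := X)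
  obtain ⟨b, hb⟩ := Metric.PiNatEmbed.exists_embedding_to_hilbert_cube (X := Y)
  choose F G hG h0 hm hle using fun n : ℕ => exists_potentials ht ha hb hlsc hconv hν hfin hπ hopt
    (ε := (1 / 2) ^ n) (by positivity)
  have hCtop : ∀ᵐ x ∂(μ : Measure X), C x (disint π x) < ⊤ :=
    ae_lt_top' (aemeasurable_cost_disint ht ha hb hlsc hν hπ) fun h => hfin (hopt ▸ h)
  refine ⟨{z | MemPt t z.2 ∧ C z.1 z.2 ≠ ⊤ ∧ Filter.Tendsto (fun n => (C z.1 z.2).toReal + F n z.1 +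
    ∫ y, G n y ∂(z.2 : Measure Y)) Filter.atTop (nhds 0)}, fun z hz => hz.1,
    fun N x p q hp hq hpq => cMonotone_of_tendsto_zero hG h0 N x p q hp hq hpq, ?_⟩
  have h0' : ∀ᵐ x ∂(μ : Measure X), ∀ n, 0 ≤ (C x (disint π x)).toReal + F n x +
      ∫ y, G n y ∂(disint π x : Measure Y) := by
    filter_upwards [hCtop, hπ.ae_memPt ht hν] with x h1 h2 n using h0 n x _ h2 h1.ne
  filter_upwards [hCtop, hπ.ae_memPt ht hν, ae_tendsto_zero_of_lintegral_ofReal_le hm hle h0']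
    with x h1 h2 h3 using ⟨h2, h1.ne, h3⟩

end
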